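/- arXiv:math/0303281 — 2 statements merged into one kernel-verified Lean document; each statement's English description precedes it below -/
import Mathlib

section
/- Let Θ ⊆ I, let w₁ ∈ W^Θ, w₂ ∈ ^{Θ∪Θ^⊥}W, and i ∈ I. Let (w₁'', w₂'') be the unique pair with w₁'' ∈ W^Θ, w₂'' ∈ ^{Θ∪Θ^⊥}W such that (σ_i w₁, w₂) ∼_Θ (w₁'', w₂''). Then: (a) if ℓ(σ_i w₁) = ℓ(w₁) + 1 and w₁⁻¹σ_i w₁ ∉ W_Θ, then ℓ(w₁'') − ℓ(w₂'') = ℓ(w₁) − ℓ(w₂) + 1; (b) if w₁⁻¹σ_i w₁ ∈ W_Θ, then (σ_i w₁, w₂) ∼_Θ (w₁, w₂), so ℓ(w₁'') − ℓ(w₂'') = ℓ(w₁) − ℓ(w₂); (c) if ℓ(σ_i w₁) = ℓ(w₁) − 1 and w₁⁻¹σ_i w₁ ∉ W_Θ, then ℓ(w₁'') − ℓ(w₂'') = ℓ(w₁) − ℓ(w₂) − 1. Moreover ℓ(w₁'') − ℓ(w₂'') = ℓ(w₁) − ℓ(w₂) if and only if (σ_i w₁, w₂) ∼_Θ (w₁,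 w₂). -/
open Classical

namespace Paper

variable {B : Type*} {M : CoxeterMatrix B} {W : Type*} [Group W]

/-- `Θ^⊥`: the indices whose simple reflections commute with all simple
reflections indexed by `Θ` (i.e. `m(i,j) = 2` for all `j ∈ Θ`). -/
def perp (M : CoxeterMatrix B) (Θ : Set B) : Set B := {i | i ∉ Θ ∧ ∀ j ∈ Θ, M i j = 2}

variable (cs : CoxeterSystem M W)

/-- The standard parabolic subgroup `W_J` generated by the simple reflections indexed by `J`. -/
def parabolic (J : Set B) : Subgroup W := Subgroup.closure (cs.simple '' J)

/-- `W^J`: the minimal-length representatives of the cosets `W/W_J`,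
`{w : ℓ(wu) = ℓ(w) + ℓ(u) for all u ∈ W_J}`. -/
def minRight (J : Set B) : Set W :=
  {w | ∀ u ∈ parabolic cs J, cs.length (w * u) = cs.length w + cs.length u}

/-- `^JW`: the minimal-length representatives of the cosets `W_J\W`,
`{w : ℓ(uw) = ℓ(u) + ℓ(w) for all u ∈ W_J}`. -/
def minLeft (J : Set B) : Set W :=
  {w | ∀ u ∈ parabolic cs J, cs.length (u * w) = cs.length u + cs.length w}

/-- The Bruhat order on `W`: `x ≤ y` iff `y` is obtained from `x` by a chain of
right multiplications by reflections, each strictly increasing the length. -/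
def bruhatLE : W → W → Prop :=
  Relation.ReflTransGen (fun x y => ∃ t, cs.IsReflection t ∧ y = x * t ∧ cs.length x < cs.length y)

/-- The equivalence relation `∼_Θ` on `W × W`:
`(x,y) ∼_Θ (x',y')` iff there are `u ∈ W_{Θ∪Θ^⊥}` and `v ∈ W_Θ` with `x' = xu`, `y' = u⁻¹vy`. -/
def simRel (Θ : Set B) (p q : W × W) : Prop :=
  ∃ u ∈ parabolic cs (Θ ∪ perp M Θ), ∃ v ∈ parabolic cs Θ,
    q.1 = p.1 * u ∧ q.2 = u⁻¹ * v * p.2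

/-- `w^J`: the minimal-length element of the coset `w W_J`. -/
noncomputable def projR (J : Set B) (w : W) : W :=
  if h : ∃ a, a ∈ minRight cs J ∧ a⁻¹ * w ∈ parabolic cs J then h.choose else w

/-- `^Jw`: the minimal-length element of the coset `W_J w`. -/
noncomputable def projL (J : Set B) (w : W) : W :=
  if h : ∃ a, a ∈ minLeft cs J ∧ w * a⁻¹ ∈ parabolic cs J then h.choose else w

theorem functionEnd_mul_apply {α : Type*} (f g : Function.End α) (x : α) : (f * g) x = f (g x) := rfl

/-- The action of a simple reflection on `W × ℤ/2`: conjugate the first component and flip the sign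
when it is the simple reflection itself. -/
noncomputable def signedConj (i : B) : Function.End (W × ZMod 2) := fun p =>
  (cs.simple i * p.1 * cs.simple i, p.2 + if p.1 = cs.simple i then 1 else 0)

theorem signedConj_mul_pow_apply (i j : B) (k : ℕ) (t : W) (e : ZMod 2) :
    ((signedConj cs i * signedConj cs j) ^ k : Function.End (W × ZMod 2)) (t, e) =
      ((cs.simple i * cs.simple j) ^ k * t * ((cs.simple i * cs.simple j) ^ k)⁻¹,
        e + ∑ n ∈ Finset.range (2 * k),
          if t = cs.simple j * (cs.simple i * cs.simple j) ^ n then 1 else 0) := by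
  induction k with
  | zero => simp [Function.End.one_def]
  | succ k ih =>
    set r := cs.simple i * cs.simple j with hr
    have hflip : (r ^ k)⁻¹ * cs.simple j = cs.simple j * r ^ k := by
      have : SemiconjBy (cs.simple j) r r⁻¹ := by
        simp [SemiconjBy, hr, mul_assoc]
      simpa using (this.pow_right k).symm
    have hj : r ^ k * t * (r ^ k)⁻¹ = cs.simple j ↔ t = cs.simple j * r ^ (2 * k) := by
      rw [mul_inv_eq_iff_eq_mul, ← eq_inv_mul_iff_mul_eq, two_mul, pow_add, ← mul_assoc,
        ← mul_assoc, hflip]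
    have hi : cs.simple j * (r ^ k * t * (r ^ k)⁻¹) * cs.simple j = cs.simple i ↔
        t = cs.simple j * r ^ (2 * k + 1) := by
      have h₁ : cs.simple j * (r ^ k * t * (r ^ k)⁻¹) * cs.simple j = cs.simple i ↔
          r ^ k * t * (r ^ k)⁻¹ = cs.simple j * r := by
        rw [← eq_mul_inv_iff_mul_eq, ← eq_inv_mul_iff_mul_eq, cs.inv_simple, hr]
      rw [h₁, mul_inv_eq_iff_eq_mul, ← eq_inv_mul_iff_mul_eq, ← mul_assoc, ← mul_assoc, hflip]
      have h₂ : r ^ (2 * k + 1) = r ^ k * r * r ^ k := by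
        rw [← pow_succ, ← pow_add]
        congr 1
        omega
      rw [h₂]
      simp only [mul_assoc]
    rw [pow_succ', functionEnd_mul_apply, ih, functionEnd_mul_apply,
      show 2 * (k + 1) = 2 * k + 1 + 1 by ring, Finset.sum_range_succ, Finset.sum_range_succ]
    simp only [signedConj, hi, hj]
    refine Prod.ext ?_ ?_
    · simp [pow_succ', hr, mul_assoc]
    · simp only [add_assoc]

theorem signedConj_isLiftable : M.IsLiftable (signedConj cs) := by
  intro i j
  funext ⟨t, e⟩
  rw [signedConj_mul_pow_apply, two_mul, Finset.sum_range_add]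
  simp [pow_add, CharTwo.add_self_eq_zero, Function.End.one_def]

theorem lift_signedConj_wordProd (ω : List B) (t : W) (e : ZMod 2) :
    cs.lift ⟨_, signedConj_isLiftable cs⟩ (cs.wordProd ω) (t, e) =
      (cs.wordProd ω * t * (cs.wordProd ω)⁻¹, e + (cs.rightInvSeq ω).count t) := by
  induction ω with
  | nil => simp [Function.End.one_def]
  | cons i ω ih =>
    have h : cs.wordProd ω * t * (cs.wordProd ω)⁻¹ = cs.simple i ↔
        (cs.wordProd ω)⁻¹ * cs.simple i * cs.wordProd ω = t := by
      rw [mul_inv_eq_iff_eq_mul, ← eq_inv_mul_iff_mul_eq, ← mul_assoc, eq_comm]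
    rw [cs.wordProd_cons, map_mul, functionEnd_mul_apply, ih, cs.lift_apply_simple]
    simp only [signedConj, CoxeterSystem.rightInvSeq, List.count_cons, h, beq_iff_eq]
    refine Prod.ext ?_ ?_
    · simp [mul_assoc]
    · push_cast
      rw [add_assoc]

/-- The exchange condition: a right descent of `w` occurs in the right inversion sequence of every
word for `w`. -/
theorem simple_mem_rightInvSeq_of_isRightDescent {ω : List B} {j : B}
    (h : cs.IsRightDescent (cs.wordProd ω) j) : cs.simple j ∈ cs.rightInvSeq ω := by
  by_contra hmem
  obtain ⟨ω', hω', hw⟩ := cs.exists_isReduced (cs.wordProd ω * cs.simple j)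
  have hword : cs.wordProd ω = cs.wordProd ω' * cs.simple j := by
    rw [← hw, cs.simple_mul_simple_cancel_right]
  have hcount := lift_signedConj_wordProd cs ω (cs.simple j) 0
  rw [List.count_eq_zero_of_not_mem hmem, hword, map_mul, functionEnd_mul_apply,
    cs.lift_apply_simple, signedConj, lift_signedConj_wordProd] at hcount
  have hmem' : cs.simple j ∈ cs.rightInvSeq ω' := by
    by_contra h'
    simp [List.count_eq_zero_of_not_mem h'] at hcount
  have hlt := (cs.isRightInversion_of_mem_rightInvSeq hω' hmem').2
  rw [← hword, ← hw] at hlt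
  exact lt_asymm h hlt

/-- The folding condition. -/
theorem simple_mul_eq_mul_simple_of_length {w : W} {i j : B}
    (hi : cs.length (cs.simple i * w) = cs.length w + 1)
    (hj : cs.length (w * cs.simple j) = cs.length w + 1)
    (hij : cs.length (cs.simple i * w * cs.simple j) < cs.length (cs.simple i * w)) :
    w⁻¹ * cs.simple i * w = cs.simple j := by
  obtain ⟨ω, hω, rfl⟩ := cs.exists_isReduced w
  have hdesc : cs.IsRightDescent (cs.wordProd (i :: ω)) j := by
    rwa [CoxeterSystem.IsRightDescent, cs.wordProd_cons]
  have hmem := simple_mem_rightInvSeq_of_isRightDescent cs hdesc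
  rw [CoxeterSystem.rightInvSeq, List.mem_cons] at hmem
  rcases hmem with h | h
  · exact h.symm
  · have := (cs.isRightInversion_of_mem_rightInvSeq hω h).2
    omega

theorem minRight_eq_of_mul_mem {J : Set B} {x u : W} (hx : x ∈ minRight cs J)
    (hu : u ∈ parabolic cs J) (hxu : x * u ∈ minRight cs J) : x * u = x := by
  have h₁ := hx u hu
  have h₂ := hxu u⁻¹ (inv_mem hu)
  rw [mul_inv_cancel_right, cs.length_inv] at h₂
  have : u = 1 := cs.length_eq_zero_iff.mp (by omega)
  simp [this]

theorem minLeft_eq_one_of_mul_mem {J : Set B} {y u : W} (hy : y ∈ minLeft cs J)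
    (hu : u ∈ parabolic cs J) (huy : u * y ∈ minLeft cs J) : u = 1 := by
  have h₁ := hy u hu
  have h₂ := huy u⁻¹ (inv_mem hu)
  rw [inv_mul_cancel_left, cs.length_inv] at h₂
  exact cs.length_eq_zero_iff.mp (by omega)

theorem simple_mul_mem_minRight_of_length_lt {J : Set B} {w : W} {i : B}
    (hw : w ∈ minRight cs J) (hi : cs.length (cs.simple i * w) + 1 = cs.length w) :
    cs.simple i * w ∈ minRight cs J := by
  intro u hu
  have h₁ := hw u hu
  have h₂ := cs.length_mul_le (cs.simple i * w) u
  have h₃ := cs.length_simple_mul (w * u) i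
  rw [← mul_assoc] at h₃
  omega

/-- If two related pairs have second components minimal in their `W_{Θ ∪ Θ^⊥}`-cosets, then these
components agree and the first components differ by an element of `W_Θ`. -/
theorem exists_of_simRel_of_minLeft {Θ : Set B} {x x' y y' : W}
    (hy : y ∈ minLeft cs (Θ ∪ perp M Θ)) (hy' : y' ∈ minLeft cs (Θ ∪ perp M Θ))
    (h : simRel cs Θ (x, y) (x', y')) : y' = y ∧ ∃ u ∈ parabolic cs Θ, x' = x * u := by
  obtain ⟨u, hu, v, hv, hx, hy₂⟩ := h
  simp only at hx hy₂
  have hv' : v ∈ parabolic cs (Θ ∪ perp M Θ) :=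
    Subgroup.closure_mono (Set.image_mono Set.subset_union_left) hv
  have huv : u⁻¹ * v = 1 :=
    minLeft_eq_one_of_mul_mem cs hy (mul_mem (inv_mem hu) hv') (hy₂ ▸ hy')
  refine ⟨by rw [hy₂, huv, one_mul], u, ?_, hx⟩
  rwa [inv_mul_eq_one.mp huv]

theorem length_eq_add_one_of_simple_mul_mul_mem {J : Set B} {w u : W} {i : B}
    (hw : w ∈ minRight cs J) (hu : u ∈ parabolic cs J)
    (hwu : cs.simple i * w * u ∈ minRight cs J)
    (hi : cs.length (cs.simple i * w) = cs.length w + 1)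
    (hJ : w⁻¹ * cs.simple i * w ∉ parabolic cs J) :
    cs.length (cs.simple i * w * u) = cs.length w + 1 := by
  have h₁ := hwu u⁻¹ (inv_mem hu)
  rw [mul_inv_cancel_right, cs.length_inv] at h₁
  have h₂ := hw u hu
  have h₃ := cs.length_simple_mul (w * u) i
  rw [← mul_assoc] at h₃
  by_contra hne
  obtain ⟨j, rfl⟩ := cs.length_eq_one_iff.mp (show cs.length u = 1 by omega)
  rw [cs.length_simple] at h₁ h₂
  exact hJ (simple_mul_eq_mul_simple_of_length cs hi h₂ (by omega) ▸ hu)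

/-- behaviour of the extended length `l₊₊ = ℓ(w₁) - ℓ(w₂)` under
left multiplication by a simple reflection `σ_i`. -/
theorem statement13 [Finite B] (Θ : Set B) (w₁ w₂ : W) (i : B)
    (h₁ : w₁ ∈ minRight cs Θ) (h₂ : w₂ ∈ minLeft cs (Θ ∪ perp M Θ))
    (w₁'' w₂'' : W)
    (h₁'' : w₁'' ∈ minRight cs Θ) (h₂'' : w₂'' ∈ minLeft cs (Θ ∪ perp M Θ))
    (hsim : simRel cs Θ (cs.simple i * w₁, w₂) (w₁'', w₂'')) :
    ((cs.length (cs.simple i * w₁) = cs.length w₁ + 1 →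
        w₁⁻¹ * cs.simple i * w₁ ∉ parabolic cs Θ →
        (cs.length w₁'' : ℤ) - cs.length w₂'' = (cs.length w₁ : ℤ) - cs.length w₂ + 1) ∧
      (w₁⁻¹ * cs.simple i * w₁ ∈ parabolic cs Θ →
        simRel cs Θ (cs.simple i * w₁, w₂) (w₁, w₂) ∧
        (cs.length w₁'' : ℤ) - cs.length w₂'' = (cs.length w₁ : ℤ) - cs.length w₂) ∧
      (cs.length (cs.simple i * w₁) + 1 = cs.length w₁ →
        w₁⁻¹ * cs.simple i * w₁ ∉ parabolic cs Θ →
        (cs.length w₁'' : ℤ) - cs.length w₂'' = (cs.length w₁ : ℤ) - cs.length w₂ - 1)) ∧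
    ((cs.length w₁'' : ℤ) - cs.length w₂'' = (cs.length w₁ : ℤ) - cs.length w₂ ↔
      simRel cs Θ (cs.simple i * w₁, w₂) (w₁, w₂)) := by
  obtain ⟨rfl, u, hu, rfl⟩ := exists_of_simRel_of_minLeft cs h₂ h₂'' hsim
  have hb (h : w₁⁻¹ * cs.simple i * w₁ ∈ parabolic cs Θ) :
      simRel cs Θ (cs.simple i * w₁, w₂'') (w₁, w₂'') ∧
        cs.length (cs.simple i * w₁ * u) = cs.length w₁ := by
    have hmul : w₁ * (w₁⁻¹ * cs.simple i * w₁) = cs.simple i * w₁ := by group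
    have hinv : cs.simple i * w₁ * (w₁⁻¹ * cs.simple i * w₁) = w₁ := by simp [mul_assoc]
    refine ⟨⟨_, Subgroup.closure_mono (Set.image_mono Set.subset_union_left) h, _, h, ?_, ?_⟩, ?_⟩
    · exact hinv.symm
    · exact (by rw [inv_mul_cancel, one_mul])
    · rw [← hmul, mul_assoc] at h₁'' ⊢
      rw [minRight_eq_of_mul_mem cs h₁ (mul_mem h hu) h₁'']
  have ha (hi : cs.length (cs.simple i * w₁) = cs.length w₁ + 1)
      (h : w₁⁻¹ * cs.simple i * w₁ ∉ parabolic cs Θ) :=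
    length_eq_add_one_of_simple_mul_mul_mem cs h₁ hu h₁'' hi h
  have hc (hi : cs.length (cs.simple i * w₁) + 1 = cs.length w₁) :
      cs.length (cs.simple i * w₁ * u) + 1 = cs.length w₁ := by
    rw [minRight_eq_of_mul_mem cs (simple_mul_mem_minRight_of_length_lt cs h₁ hi) hu h₁'', hi]
  refine ⟨⟨fun hi h => ?_, fun h => ⟨(hb h).1, ?_⟩, fun hi _ => ?_⟩, fun h => ?_, fun h => ?_⟩
  · have := ha hi h
    omega
  · have := (hb h).2
    omega
  · have := hc hi
    omega
  · by_contra hsim'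
    have hJ : w₁⁻¹ * cs.simple i * w₁ ∉ parabolic cs Θ := fun hJ => hsim' (hb hJ).1
    rcases cs.length_simple_mul w₁ i with hi | hi
    · have := ha hi hJ
      omega
    · have := hc hi
      omega
  · obtain ⟨-, v, hv, hw⟩ := exists_of_simRel_of_minLeft cs h₂ h₂ h
    have : w₁⁻¹ * cs.simple i * w₁ = v⁻¹ := by
      rw [eq_inv_iff_mul_eq_one, mul_assoc, mul_assoc, ← mul_assoc (cs.simple i), ← hw,
        inv_mul_cancel]
    rw [(hb (this ▸ inv_mem hv)).2]

end Paper
end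

section
/- Let X be a topological space, let A and B be irreducible topological spaces, and let f : A × B → X be a map that is separately continuous, i.e., for every a ∈ A the map b ↦ f(a,b) is continuous and for every b ∈ B the map a ↦ f(a,b) is continuous. Then the image f(A × B) is an irreducible subset of X. -/
/-- if `A`, `B` are irreducible topological spaces, `X` a topological
space and `f : A × B → X` is separately continuous, then the image `f(A × B)`
is an irreducible subset of `X`. -/
theorem statement19 {X A B : Type*} [TopologicalSpace X] [TopologicalSpace A]
    [TopologicalSpace B] [IrreducibleSpace A] [IrreducibleSpace B] (f : A × B → X)
    (h1 : ∀ a : A, Continuous fun b : B => f (a, b))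
    (h2 : ∀ b : B, Continuous fun a : A => f (a, b)) :
    IsIrreducible (Set.range f) := by
  refine ⟨Set.range_nonempty f, ?_⟩
  rintro U V hU hV ⟨_, ⟨⟨a, b⟩, rfl⟩, hab⟩ ⟨_, ⟨⟨a', b'⟩, rfl⟩, hab'⟩
  obtain ⟨x, hxU, hxV⟩ := nonempty_preirreducible_inter
    (hU.preimage (h2 b)) (hV.preimage (h2 b')) ⟨a, hab⟩ ⟨a', hab'⟩
  obtain ⟨y, hyU, hyV⟩ := nonempty_preirreducible_inter
    (hU.preimage (h1 x)) (hV.preimage (h1 x)) ⟨b, hxU⟩ ⟨b', hxV⟩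
  exact ⟨f (x, y), ⟨(x, y), rfl⟩, hyU, hyV⟩
end
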